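/- arXiv:2402.14661 — 3 statements merged into one kernel-verified Lean document; each statement's English description precedes it below -/
import Mathlib

section
/- Let X = C[8,1] be the 8-element quandle given in the context and let 𝓘 = 𝓘(ℤ₂[X]) be the set of idempotents of the quandle ring ℤ₂[X]. Then: (a) 𝓘 has exactly 16 elements; (b) 𝓘 is closed under the quandle-ring multiplication; (c) the multiplication restricted to 𝓘 satisfies the quandle axioms: u·u = u for all u ∈ 𝓘, (u·v)·w = (u·w)·(v·w) for all u,v,w ∈ 𝓘, and for each v ∈ 𝓘 the map u ↦ u·v is a bijection of 𝓘. Hence (𝓘(ℤ₂[C[8,1]]), ·) is a quandle of order 16. -/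
/-- The quandle ring multiplication on `ℤ₂[X]`, modeled as functions `X → ZMod 2`:
`(u · v)(z) = ∑_{(x,y), x∗y = z} u(x)·v(y)`. -/
def qmul {n : ℕ} (op : Fin n → Fin n → Fin n) (u v : Fin n → ZMod 2) :
    Fin n → ZMod 2 :=
  fun z => ∑ x : Fin n, ∑ y : Fin n, if op x y = z then u x * v y else 0

/-- The basis element `e_x`, the indicator function of `{x}`. -/
def eb {n : ℕ} (x : Fin n) : Fin n → ZMod 2 :=
  fun z => if z = x then 1 else 0

/-- The connected quandle `C[8,1]` on `{1,…,8}` (here `0`-indexed on `Fin 8`),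
with `x∗y` given by the right translations
`S₁ = S₂ = (3 6 7)(4 5 8)`, `S₃ = S₄ = (1 8 6)(2 5 7)`,
`S₅ = S₆ = (1 4 7)(2 3 8)`, `S₇ = S₈ = (1 5 3)(2 6 4)`. -/
def opC81 : Fin 8 → Fin 8 → Fin 8 := fun x y =>
  ![![0, 0, 5, 5, 6, 6, 2, 2],
   ![1, 1, 4, 4, 7, 7, 3, 3],
   ![6, 6, 2, 2, 1, 1, 4, 4],
   ![7, 7, 3, 3, 0, 0, 5, 5],
   ![3, 3, 6, 6, 4, 4, 0, 0],
   ![2, 2, 7, 7, 5, 5, 1, 1],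
   ![5, 5, 1, 1, 3, 3, 6, 6],
   ![4, 4, 0, 0, 2, 2, 7, 7]] x y

/-- Right division in `C[8,1]`: `divC81 z y` is the unique `x` with `x∗y = z`. -/
def divC81 : Fin 8 → Fin 8 → Fin 8 := fun z y =>
  ![![0, 0, 7, 7, 3, 3, 4, 4],
   ![1, 1, 6, 6, 2, 2, 5, 5],
   ![5, 5, 2, 2, 7, 7, 0, 0],
   ![4, 4, 3, 3, 6, 6, 1, 1],
   ![7, 7, 1, 1, 4, 4, 2, 2],
   ![6, 6, 0, 0, 5, 5, 3, 3],
   ![2, 2, 4, 4, 0, 0, 6, 6],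
   ![3, 3, 5, 5, 1, 1, 7, 7]] z y

/-- The function `a + e_x`; these are exactly the idempotents of `ℤ₂[C[8,1]]`. -/
def addBasis (p : ZMod 2 × Fin 8) : Fin 8 → ZMod 2 :=
  fun z => p.1 + eb p.2 z

theorem opC81_eq_iff : ∀ x y z, opC81 x y = z ↔ x = divC81 z y := by
  decide +kernel

theorem qmul_opC81_apply (u v : Fin 8 → ZMod 2) (z : Fin 8) :
    qmul opC81 u v z = ∑ y, u (divC81 z y) * v y := by
  simp only [qmul, opC81_eq_iff]
  rw [Finset.sum_comm]
  simp

theorem sum_eb_divC81 : ∀ x z, ∑ y, eb x (divC81 z y) = 0 := by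
  decide +kernel

theorem eb_divC81 (x y z : Fin 8) : eb x (divC81 z y) = eb (opC81 x y) z := by
  simp only [eb, eq_comm (a := z), opC81_eq_iff, eq_comm (a := x)]

theorem qmul_addBasis (p q : ZMod 2 × Fin 8) :
    qmul opC81 (addBasis p) (addBasis q) = addBasis (p.1, opC81 p.2 q.2) := by
  obtain ⟨a, x⟩ := p
  obtain ⟨b, y⟩ := q
  funext z
  have h_sum : ∑ k, addBasis (a, x) (divC81 z k) = 0 := by
    have h_two : (8 : ZMod 2) = 0 := by decide
    simp [addBasis, Finset.sum_add_distrib, sum_eb_divC81, h_two]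
  have h_pick : ∑ k, addBasis (a, x) (divC81 z k) * eb y k = addBasis (a, x) (divC81 z y) := by
    simp [eb]
  rw [qmul_opC81_apply]
  calc ∑ k, addBasis (a, x) (divC81 z k) * addBasis (b, y) k
      = (∑ k, addBasis (a, x) (divC81 z k)) * b
          + ∑ k, addBasis (a, x) (divC81 z k) * eb y k := by
        rw [Finset.sum_mul, ← Finset.sum_add_distrib]
        exact Finset.sum_congr rfl fun k _ => mul_add _ _ _
    _ = addBasis (a, opC81 x y) z := by
        rw [h_sum, h_pick, zero_mul, zero_add]
        simp only [addBasis, eb_divC81]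

theorem addBasis_injective : Function.Injective addBasis := by
  decide +kernel

theorem addBasis_ne_zero : ∀ p, addBasis p ≠ 0 := by
  decide +kernel

theorem exists_addBasis_of_idempotent (u : Fin 8 → ZMod 2) (hu₀ : u ≠ 0)
    (hu : qmul opC81 u u = u) : ∃ p, addBasis p = u := by
  have h_all : ∀ a b c d e f g h : ZMod 2,
      (∀ z, ∑ y, ![a, b, c, d, e, f, g, h] (divC81 z y) * ![a, b, c, d, e, f, g, h] y
        = ![a, b, c, d, e, f, g, h] z) →
      ![a, b, c, d, e, f, g, h] ≠ 0 → ∃ p, addBasis p = ![a, b, c, d, e, f, g, h] := by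
    decide +kernel
  have hu_eta : u = ![u 0, u 1, u 2, u 3, u 4, u 5, u 6, u 7] := by
    funext z
    fin_cases z <;> rfl
  rw [hu_eta] at hu hu₀ ⊢
  exact h_all _ _ _ _ _ _ _ _
    (fun z => (qmul_opC81_apply _ _ z).symm.trans (congrFun hu z)) hu₀

theorem opC81_self : ∀ x, opC81 x x = x := by
  decide

theorem opC81_right_distrib :
    ∀ x y z, opC81 (opC81 x y) z = opC81 (opC81 x z) (opC81 y z) := by
  decide +kernel

theorem opC81_divC81 (x y : Fin 8) : opC81 (divC81 x y) y = x :=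
  (opC81_eq_iff _ _ _).2 rfl

theorem divC81_opC81 (x y : Fin 8) : divC81 (opC81 x y) y = x :=
  ((opC81_eq_iff _ _ _).1 rfl).symm

theorem mem_idempotents_iff (u : Fin 8 → ZMod 2) :
    (u ≠ 0 ∧ qmul opC81 u u = u) ↔ ∃ p, addBasis p = u := by
  refine ⟨fun h => exists_addBasis_of_idempotent u h.1 h.2, ?_⟩
  rintro ⟨p, rfl⟩
  exact ⟨addBasis_ne_zero p, by rw [qmul_addBasis, opC81_self]⟩

/-- The set `𝓘(ℤ₂[C[8,1]])` of idempotents of the quandle ring `ℤ₂[C[8,1]]` has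
exactly `16` elements, is closed under the quandle-ring multiplication, and this
multiplication satisfies the quandle axioms on it; hence `(𝓘(ℤ₂[C[8,1]]), ·)` is
a quandle of order `16`. -/
theorem C81_idempotents_form_quandle
    (I : Finset (Fin 8 → ZMod 2))
    (hI : I = Finset.univ.filter fun u => u ≠ 0 ∧ qmul opC81 u u = u) :
    I.card = 16 ∧
      (∀ u ∈ I, ∀ v ∈ I, qmul opC81 u v ∈ I) ∧
      (∀ u ∈ I, qmul opC81 u u = u) ∧
      (∀ u ∈ I, ∀ v ∈ I, ∀ w ∈ I,
        qmul opC81 (qmul opC81 u v) w = qmul opC81 (qmul opC81 u w) (qmul opC81 v w)) ∧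
      (∀ v ∈ I, Set.BijOn (fun u => qmul opC81 u v) ↑I ↑I) := by
  have h_mem : ∀ u, u ∈ I ↔ ∃ p, addBasis p = u := fun u => by
    simp only [hI, Finset.mem_filter, Finset.mem_univ, true_and, mem_idempotents_iff]
  have h_image : I = Finset.univ.image addBasis := by
    ext u
    simp only [h_mem, Finset.mem_image, Finset.mem_univ, true_and]
  simp only [Set.BijOn, Set.MapsTo, Set.InjOn, Set.SurjOn, Set.subset_def, Set.mem_image,
    Finset.mem_coe, h_mem]
  refine ⟨?_, ?_, ?_, ?_, ?_⟩
  · rw [h_image, Finset.card_image_of_injective _ addBasis_injective]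
    simp [ZMod.card]
  · rintro _ ⟨p, rfl⟩ _ ⟨q, rfl⟩
    exact ⟨_, (qmul_addBasis p q).symm⟩
  · rintro _ ⟨p, rfl⟩
    rw [qmul_addBasis, opC81_self]
  · rintro _ ⟨p, rfl⟩ _ ⟨q, rfl⟩ _ ⟨r, rfl⟩
    simp only [qmul_addBasis]
    rw [opC81_right_distrib]
  · rintro _ ⟨q, rfl⟩
    refine ⟨?_, ?_, ?_⟩
    · rintro _ ⟨p, rfl⟩
      exact ⟨_, (qmul_addBasis p q).symm⟩
    · rintro _ ⟨⟨a, x⟩, rfl⟩ _ ⟨⟨b, y⟩, rfl⟩ h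
      simp only [qmul_addBasis] at h
      obtain ⟨h_fst, h_snd⟩ := Prod.mk.inj (addBasis_injective h)
      rw [← divC81_opC81 x q.2, h_snd, divC81_opC81, h_fst]
    · rintro _ ⟨⟨a, x⟩, rfl⟩
      exact ⟨_, ⟨(a, divC81 x q.2), rfl⟩, by rw [qmul_addBasis, opC81_divC81]⟩
end

section
/- Let X = C[12,3] be the 12-element quandle given in the context and let 𝓘 = 𝓘(ℤ₂[X]) be the set of idempotents of the quandle ring ℤ₂[X]. Then: (a) 𝓘 has exactly 24 elements; (b) 𝓘 is closed under the quandle-ring multiplication; (c) the multiplication restricted to 𝓘 satisfies the quandle axioms: u·u = u for all u ∈ 𝓘, (u·v)·w = (u·w)·(v·w) for all u,v,w ∈ 𝓘, and for each v ∈ 𝓘 the map u ↦ u·v is a bijection of 𝓘. Hence (𝓘(ℤ₂[C[12,3]]), ·) is a quandle of order 24. -/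
/-- The connected quandle `C[12,3]` on `{1,…,12}` (here `0`-indexed on `Fin 12`),
with `x∗y` given by the right translations `S₁, …, S₁₂` listed in the paper. -/
def opC123 : Fin 12 → Fin 12 → Fin 12 := fun x y =>
  ![![0, 11, 9, 4, 9, 1, 11, 10, 0, 10, 1, 4],
   ![10, 1, 0, 11, 10, 3, 3, 1, 11, 6, 6, 0],
   ![3, 8, 2, 8, 11, 4, 7, 4, 7, 11, 2, 3],
   ![6, 6, 11, 3, 1, 2, 8, 11, 2, 3, 8, 1],
   ![11, 2, 7, 7, 4, 0, 4, 9, 9, 0, 11, 2],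
   ![7, 9, 6, 10, 8, 5, 10, 8, 6, 7, 9, 5],
   ![5, 10, 1, 1, 6, 8, 6, 3, 3, 8, 5, 10],
   ![2, 7, 8, 5, 2, 9, 9, 7, 5, 4, 4, 8],
   ![8, 5, 3, 6, 3, 7, 5, 2, 8, 2, 7, 6],
   ![4, 4, 5, 9, 7, 10, 0, 5, 10, 9, 0, 7],
   ![9, 0, 10, 0, 5, 6, 1, 6, 1, 5, 10, 9],
   ![1, 3, 4, 2, 0, 11, 2, 0, 4, 1, 3, 11]] x y

/-- The inverse right translations of `C[12,3]`: all `S_y` have order dividing `5`, so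
`S_y⁻¹ = S_y⁴`. -/
def divC123 (z y : Fin 12) : Fin 12 :=
  opC123 (opC123 (opC123 (opC123 z y) y) y) y

lemma opC123_eq_iff (x y z : Fin 12) : opC123 x y = z ↔ x = divC123 z y := by
  revert x y z; decide +kernel

lemma opC123_self (x : Fin 12) : opC123 x x = x := by
  revert x; decide +kernel

lemma opC123_distrib (x y z : Fin 12) :
    opC123 (opC123 x y) z = opC123 (opC123 x z) (opC123 y z) := by
  revert x y z; decide +kernel

/-- Every element occurs an even number of times in every row of the table of `C[12,3]`. -/
lemma sum_eb_divC123 (x z : Fin 12) : ∑ y, eb x (divC123 z y) = 0 := by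
  revert x z; decide +kernel

lemma qmul_opC123_apply (u v : Fin 12 → ZMod 2) (z : Fin 12) :
    qmul opC123 u v z = ∑ y, u (divC123 z y) * v y := by
  simp only [qmul, opC123_eq_iff]
  rw [Finset.sum_comm]
  simp

/-- The basis element `e_x` translated by the constant function `a`. -/
def ebAdd (x : Fin 12) (a : ZMod 2) : Fin 12 → ZMod 2 :=
  fun z => eb x z + a

lemma qmul_ebAdd (x y : Fin 12) (a b : ZMod 2) :
    qmul opC123 (ebAdd x a) (ebAdd y b) = ebAdd (opC123 x y) a := by
  funext z
  have hy : ∀ f : Fin 12 → ZMod 2, ∑ t, f t * eb y t = f y := by simp [eb]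
  have h₁ : eb x (divC123 z y) = eb (opC123 x y) z := by
    simp only [eb, ← opC123_eq_iff, eq_comm]
  have h₂ : (12 : ZMod 2) = 0 := by decide
  rw [qmul_opC123_apply]
  simp only [ebAdd, mul_add, Finset.sum_add_distrib, ← Finset.sum_mul, sum_eb_divC123, hy, h₁]
  simp [h₂]

lemma ebAdd_injective {x y : Fin 12} {a b : ZMod 2} (h : ebAdd x a = ebAdd y b) :
    x = y ∧ a = b := by
  revert x y a b; decide +kernel

lemma ebAdd_ne_zero (x : Fin 12) (a : ZMod 2) : ebAdd x a ≠ 0 := by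
  revert x a; decide +kernel

/-- The idempotent equation `u · u = u`, written out in coordinates, has only the solutions
`u = 0` and `u = e_x + a`. -/
lemma eq_zero_or_ebAdd_of_equations : ∀ a0 a1 a2 a3 a4 a5 a6 a7 a8 a9 a10 a11 : ZMod 2,
    a0 * a0 + a10 * a1 + a1 * a2 + a10 * a3 + a11 * a4 + a4 * a5 +
      a9 * a6 + a11 * a7 + a0 * a8 + a4 * a9 + a9 * a10 + a1 * a11 = a0 →
    a11 * a0 + a1 * a1 + a6 * a2 + a6 * a3 + a3 * a4 + a0 * a5 +
      a10 * a6 + a1 * a7 + a10 * a8 + a11 * a9 + a0 * a10 + a3 * a11 = a1 →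
    a7 * a0 + a4 * a1 + a2 * a2 + a11 * a3 + a7 * a4 + a3 * a5 +
      a11 * a6 + a8 * a7 + a3 * a8 + a8 * a9 + a2 * a10 + a4 * a11 = a2 →
    a2 * a0 + a11 * a1 + a8 * a2 + a3 * a3 + a8 * a4 + a1 * a5 +
      a1 * a6 + a6 * a7 + a6 * a8 + a3 * a9 + a11 * a10 + a2 * a11 = a3 →
    a9 * a0 + a9 * a1 + a11 * a2 + a0 * a3 + a4 * a4 + a2 * a5 +
      a4 * a6 + a2 * a7 + a11 * a8 + a7 * a9 + a7 * a10 + a0 * a11 = a4 →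
    a6 * a0 + a8 * a1 + a9 * a2 + a7 * a3 + a10 * a4 + a5 * a5 +
      a8 * a6 + a9 * a7 + a7 * a8 + a10 * a9 + a6 * a10 + a5 * a11 = a5 →
    a3 * a0 + a3 * a1 + a5 * a2 + a8 * a3 + a6 * a4 + a10 * a5 +
      a6 * a6 + a10 * a7 + a5 * a8 + a1 * a9 + a1 * a10 + a8 * a11 = a6 →
    a5 * a0 + a7 * a1 + a4 * a2 + a4 * a3 + a9 * a4 + a8 * a5 +
      a2 * a6 + a7 * a7 + a2 * a8 + a5 * a9 + a8 * a10 + a9 * a11 = a7 →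
    a8 * a0 + a2 * a1 + a7 * a2 + a2 * a3 + a5 * a4 + a6 * a5 +
      a3 * a6 + a5 * a7 + a8 * a8 + a6 * a9 + a3 * a10 + a7 * a11 = a8 →
    a10 * a0 + a5 * a1 + a0 * a2 + a9 * a3 + a0 * a4 + a7 * a5 +
      a7 * a6 + a4 * a7 + a4 * a8 + a9 * a9 + a5 * a10 + a10 * a11 = a9 →
    a1 * a0 + a6 * a1 + a10 * a2 + a5 * a3 + a1 * a4 + a9 * a5 +
      a5 * a6 + a0 * a7 + a9 * a8 + a0 * a9 + a10 * a10 + a6 * a11 = a10 →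
    a4 * a0 + a0 * a1 + a3 * a2 + a1 * a3 + a2 * a4 + a11 * a5 +
      a0 * a6 + a3 * a7 + a1 * a8 + a2 * a9 + a4 * a10 + a11 * a11 = a11 →
    ![a0, a1, a2, a3, a4, a5, a6, a7, a8, a9, a10, a11] = 0 ∨
      ∃ x a, ![a0, a1, a2, a3, a4, a5, a6, a7, a8, a9, a10, a11] = ebAdd x a := by
  decide +kernel

lemma qmul_self_iff (u : Fin 12 → ZMod 2) :
    u ≠ 0 ∧ qmul opC123 u u = u ↔ ∃ x a, u = ebAdd x a := by
  constructor
  · rintro ⟨h₀, h⟩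
    have hu : u = ![u 0, u 1, u 2, u 3, u 4, u 5, u 6, u 7, u 8, u 9, u 10, u 11] := by
      funext z; fin_cases z <;> rfl
    have h_coord (z : Fin 12) : ∑ y, u (divC123 z y) * u y = u z := by
      rw [← qmul_opC123_apply, h]
    simp only [Fin.sum_univ_succ, Fin.sum_univ_zero, add_zero, ← add_assoc] at h_coord
    have key := eq_zero_or_ebAdd_of_equations
      (u 0) (u 1) (u 2) (u 3) (u 4) (u 5)
      (u 6) (u 7) (u 8) (u 9) (u 10) (u 11)
      (h_coord 0) (h_coord 1) (h_coord 2) (h_coord 3) (h_coord 4) (h_coord 5)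
      (h_coord 6) (h_coord 7) (h_coord 8) (h_coord 9) (h_coord 10) (h_coord 11)
    rw [← hu] at key
    exact key.resolve_left h₀
  · rintro ⟨x, a, rfl⟩
    exact ⟨ebAdd_ne_zero x a, by rw [qmul_ebAdd, opC123_self]⟩

/-- The set `𝓘(ℤ₂[C[12,3]])` of idempotents of the quandle ring `ℤ₂[C[12,3]]` has
exactly `24` elements, is closed under the quandle-ring multiplication, and this
multiplication satisfies the quandle axioms on it; hence `(𝓘(ℤ₂[C[12,3]]), ·)` is
a quandle of order `24`. -/
theorem C123_idempotents_form_quandle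
    (I : Finset (Fin 12 → ZMod 2))
    (hI : I = Finset.univ.filter fun u => u ≠ 0 ∧ qmul opC123 u u = u) :
    I.card = 24 ∧
      (∀ u ∈ I, ∀ v ∈ I, qmul opC123 u v ∈ I) ∧
      (∀ u ∈ I, qmul opC123 u u = u) ∧
      (∀ u ∈ I, ∀ v ∈ I, ∀ w ∈ I,
        qmul opC123 (qmul opC123 u v) w = qmul opC123 (qmul opC123 u w) (qmul opC123 v w)) ∧
      (∀ v ∈ I, Set.BijOn (fun u => qmul opC123 u v) ↑I ↑I) := by
  have mem (u) : u ∈ I ↔ ∃ x a, u = ebAdd x a := by simp [hI, qmul_self_iff]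
  refine ⟨?_, ?_, ?_, ?_, ?_⟩
  · have hI' : I = Finset.univ.image fun p : Fin 12 × ZMod 2 => ebAdd p.1 p.2 := by
      ext u; simp [mem, eq_comm]
    rw [hI', Finset.card_image_of_injective]
    · simp
    · rintro ⟨x, a⟩ ⟨y, b⟩ h
      exact Prod.ext_iff.mpr (ebAdd_injective h)
  · simp only [mem]
    rintro _ ⟨x, a, rfl⟩ _ ⟨y, b, rfl⟩
    exact ⟨_, _, qmul_ebAdd x y a b⟩
  · simp only [mem]
    rintro _ ⟨x, a, rfl⟩
    rw [qmul_ebAdd, opC123_self]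
  · simp only [mem]
    rintro _ ⟨x, a, rfl⟩ _ ⟨y, b, rfl⟩ _ ⟨z, c, rfl⟩
    simp only [qmul_ebAdd]
    rw [opC123_distrib]
  · intro v hv
    obtain ⟨y, b, rfl⟩ := (mem v).mp hv
    refine ⟨?_, ?_, ?_⟩
    · intro u hu
      obtain ⟨x, a, rfl⟩ := (mem u).mp hu
      exact (mem _).mpr ⟨_, _, qmul_ebAdd x y a b⟩
    · intro u hu u' hu' h
      obtain ⟨x, a, rfl⟩ := (mem u).mp hu
      obtain ⟨x', a', rfl⟩ := (mem u').mp hu'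
      simp only [qmul_ebAdd] at h
      obtain ⟨hx, rfl⟩ := ebAdd_injective h
      rw [opC123_eq_iff] at hx
      rw [hx, ← (opC123_eq_iff x' y _).mp rfl]
    · intro u hu
      obtain ⟨z, a, rfl⟩ := (mem u).mp hu
      refine ⟨ebAdd (divC123 z y) a, (mem _).mpr ⟨_, _, rfl⟩, ?_⟩
      simp only [qmul_ebAdd]
      rw [(opC123_eq_iff _ y z).mpr rfl]
end

section
/- Let Y be the 24-element quandle 𝓘(ℤ₂[C[12,3]]) given explicitly in the context, and let 𝓦 = 𝓘(ℤ₂[Y]) be the set of idempotents of the quandle ring ℤ₂[Y]. Then 𝓦 is closed under the quandle-ring multiplication and the multiplication restricted to 𝓦 satisfies the quandle axioms: u·u = u for all u ∈ 𝓦, (u·v)·w = (u·w)·(v·w) for all u,v,w ∈ 𝓦, and for each v ∈ 𝓦 the map u ↦ u·v is a bijection of 𝓦. Hence 𝓦 = 𝓘(ℤ₂[𝓘(ℤ₂[C[12,3]])]) is itself a quandle. -/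
/-- The `24`-element quandle `Y = 𝓘(ℤ₂[C[12,3]])` on `{1,…,24}` (here `0`-indexed
on `Fin 24`), with `x∗y` given by the right translations `S₁, …, S₂₄` listed in
the paper. -/
def opY : Fin 24 → Fin 24 → Fin 24 := fun x y =>
  ![![0, 11, 9, 4, 9, 1, 11, 10, 0, 10, 1, 4, 0, 11, 9, 4, 9, 1, 11, 10, 0, 10, 1, 4],
   ![10, 1, 0, 11, 10, 3, 3, 1, 11, 6, 6, 0, 10, 1, 0, 11, 10, 3, 3, 1, 11, 6, 6, 0],
   ![3, 8, 2, 8, 11, 4, 7, 4, 7, 11, 2, 3, 3, 8, 2, 8, 11, 4, 7, 4, 7, 11, 2, 3],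
   ![6, 6, 11, 3, 1, 2, 8, 11, 2, 3, 8, 1, 6, 6, 11, 3, 1, 2, 8, 11, 2, 3, 8, 1],
   ![11, 2, 7, 7, 4, 0, 4, 9, 9, 0, 11, 2, 11, 2, 7, 7, 4, 0, 4, 9, 9, 0, 11, 2],
   ![7, 9, 6, 10, 8, 5, 10, 8, 6, 7, 9, 5, 7, 9, 6, 10, 8, 5, 10, 8, 6, 7, 9, 5],
   ![5, 10, 1, 1, 6, 8, 6, 3, 3, 8, 5, 10, 5, 10, 1, 1, 6, 8, 6, 3, 3, 8, 5, 10],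
   ![2, 7, 8, 5, 2, 9, 9, 7, 5, 4, 4, 8, 2, 7, 8, 5, 2, 9, 9, 7, 5, 4, 4, 8],
   ![8, 5, 3, 6, 3, 7, 5, 2, 8, 2, 7, 6, 8, 5, 3, 6, 3, 7, 5, 2, 8, 2, 7, 6],
   ![4, 4, 5, 9, 7, 10, 0, 5, 10, 9, 0, 7, 4, 4, 5, 9, 7, 10, 0, 5, 10, 9, 0, 7],
   ![9, 0, 10, 0, 5, 6, 1, 6, 1, 5, 10, 9, 9, 0, 10, 0, 5, 6, 1, 6, 1, 5, 10, 9],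
   ![1, 3, 4, 2, 0, 11, 2, 0, 4, 1, 3, 11, 1, 3, 4, 2, 0, 11, 2, 0, 4, 1, 3, 11],
   ![12, 23, 21, 16, 21, 13, 23, 22, 12, 22, 13, 16, 12, 23, 21, 16, 21, 13, 23, 22, 12, 22, 13, 16],
   ![22, 13, 12, 23, 22, 15, 15, 13, 23, 18, 18, 12, 22, 13, 12, 23, 22, 15, 15, 13, 23, 18, 18, 12],
   ![15, 20, 14, 20, 23, 16, 19, 16, 19, 23, 14, 15, 15, 20, 14, 20, 23, 16, 19, 16, 19, 23, 14, 15],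
   ![18, 18, 23, 15, 13, 14, 20, 23, 14, 15, 20, 13, 18, 18, 23, 15, 13, 14, 20, 23, 14, 15, 20, 13],
   ![23, 14, 19, 19, 16, 12, 16, 21, 21, 12, 23, 14, 23, 14, 19, 19, 16, 12, 16, 21, 21, 12, 23, 14],
   ![19, 21, 18, 22, 20, 17, 22, 20, 18, 19, 21, 17, 19, 21, 18, 22, 20, 17, 22, 20, 18, 19, 21, 17],
   ![17, 22, 13, 13, 18, 20, 18, 15, 15, 20, 17, 22, 17, 22, 13, 13, 18, 20, 18, 15, 15, 20, 17, 22],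
   ![14, 19, 20, 17, 14, 21, 21, 19, 17, 16, 16, 20, 14, 19, 20, 17, 14, 21, 21, 19, 17, 16, 16, 20],
   ![20, 17, 15, 18, 15, 19, 17, 14, 20, 14, 19, 18, 20, 17, 15, 18, 15, 19, 17, 14, 20, 14, 19, 18],
   ![16, 16, 17, 21, 19, 22, 12, 17, 22, 21, 12, 19, 16, 16, 17, 21, 19, 22, 12, 17, 22, 21, 12, 19],
   ![21, 12, 22, 12, 17, 18, 13, 18, 13, 17, 22, 21, 21, 12, 22, 12, 17, 18, 13, 18, 13, 17, 22, 21],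
   ![13, 15, 16, 14, 12, 23, 14, 12, 16, 13, 15, 23, 13, 15, 16, 14, 12, 23, 14, 12, 16, 13, 15, 23]] x y

section Pushforward

variable {m n : ℕ}

/-- The pushforward of a function along a map of index sets, i.e. the linear extension of `f` to
the free `ℤ₂`-modules. -/
def push (f : Fin m → Fin n) (u : Fin m → ZMod 2) : Fin n → ZMod 2 :=
  fun z => ∑ x, if f x = z then u x else 0

theorem sum_push_mul (f : Fin m → Fin n) (u : Fin m → ZMod 2) (g : Fin n → ZMod 2) :
    ∑ z, push f u z * g z = ∑ x, u x * g (f x) := by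
  simp only [push, Finset.sum_mul, ite_mul, zero_mul]
  rw [Finset.sum_comm]
  simp

theorem sum_qmul_mul (op : Fin n → Fin n → Fin n) (u v g : Fin n → ZMod 2) :
    ∑ z, qmul op u v z * g z = ∑ x, u x * ∑ y, v y * g (op x y) := by
  simp only [qmul, Finset.sum_mul, ite_mul, zero_mul, Finset.mul_sum]
  rw [Finset.sum_comm]
  refine Finset.sum_congr rfl fun x _ => ?_
  rw [Finset.sum_comm]
  simp [mul_assoc]

theorem push_apply (f : Fin m → Fin n) (u : Fin m → ZMod 2) (z : Fin n) :
    push f u z = ∑ x, u x * eb z (f x) := by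
  simp [push, eb]

theorem qmul_apply (op : Fin n → Fin n → Fin n) (u v : Fin n → ZMod 2) (z : Fin n) :
    qmul op u v z = ∑ x, u x * ∑ y, v y * eb z (op x y) := by
  simp [qmul, eb, Finset.mul_sum]

/-- The linear extension of a homomorphism is multiplicative. -/
theorem push_qmul {op : Fin m → Fin m → Fin m} {op' : Fin n → Fin n → Fin n} {f : Fin m → Fin n}
    (hf : ∀ x y, f (op x y) = op' (f x) (f y)) (u v : Fin m → ZMod 2) :
    push f (qmul op u v) = qmul op' (push f u) (push f v) := by
  ext z
  rw [push_apply, sum_qmul_mul, qmul_apply, sum_push_mul]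
  simp only [sum_push_mul, hf]

theorem push_injective {f : Fin m → Fin n} (hf : Function.Injective f) :
    Function.Injective (push f) := by
  intro u v h
  ext x
  simpa [push, hf.eq_iff] using congrFun h (f x)

theorem sum_eb_mul (b : Fin n) (g : Fin n → ZMod 2) : ∑ y, eb b y * g y = g b := by
  simp [eb]

theorem push_zero (f : Fin m → Fin n) : push f 0 = 0 := by
  ext z
  simp [push]

end Pushforward

/-- The projection of the index set of `Y` onto that of `C[12,3]`. -/
def proj (x : Fin 24) : Fin 12 := ⟨x.val % 12, Nat.mod_lt _ (by decide)⟩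

/-- The section of `proj` embedding the index set of `C[12,3]` as the first twelve elements. -/
def sec (a : Fin 12) : Fin 24 := ⟨a.val, by omega⟩

/-- The quandle `C[12,3]`, as a quotient of `Y`. -/
def opC (a b : Fin 12) : Fin 12 := proj (opY (sec a) (sec b))

/-- The inverse of right translation in `C[12,3]`, whose right translations have order `5`. -/
def divC (c b : Fin 12) : Fin 12 := opC (opC (opC (opC c b) b) b) b

theorem opC_divC : ∀ c b : Fin 12, opC (divC c b) b = c := by decide +kernel

theorem opC_eq_iff (a b c : Fin 12) : opC a b = c ↔ a = divC c b :=
  ⟨fun h => by rw [← h]; exact (opC_divC a b).symm, fun h => by rw [h]; exact opC_divC c b⟩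

theorem proj_sec : ∀ a : Fin 12, proj (sec a) = a := by decide

theorem opY_sec_proj : ∀ x y : Fin 24, opY x (sec (proj y)) = opY x y := by decide +kernel

theorem proj_opY : ∀ x y : Fin 24, proj (opY x y) = opC (proj x) (proj y) := by decide +kernel

theorem opY_injective_left (y : Fin 24) : Function.Injective fun x => opY x y := by
  have h : ∀ (b : Fin 12) (x : Fin 24), opY (opY (opY (opY (opY x (sec b)) (sec b)) (sec b))
      (sec b)) (sec b) = x := by decide +kernel
  intro x x' hx
  simp only [← opY_sec_proj _ y] at hx
  rw [← h (proj y) x, hx, h]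

theorem opY_distrib (x y z : Fin 24) : opY (opY x y) z = opY (opY x z) (opY y z) := by
  have h : ∀ (x : Fin 24) (b c : Fin 12),
      opY (opY x (sec b)) (sec c) = opY (opY x (sec c)) (sec (opC b c)) := by decide +kernel
  rw [← opY_sec_proj x y, ← opY_sec_proj _ z, h, ← proj_opY, opY_sec_proj, opY_sec_proj]

/-- In each row of the multiplication table every value occurs an even number of times. -/
theorem sum_row : ∀ x z : Fin 24, ∑ b : Fin 12, eb z (opY x (sec b)) = 0 := by decide +kernel

/-- The sum modulo `2` of a tuple of booleans. -/
def parity : {n : ℕ} → (Fin n → Bool) → Bool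
  | 0, _ => false
  | _ + 1, g => xor (g 0) (parity fun i => g i.succ)

/-- The element of `ℤ₂` given by a boolean. -/
def bit (b : Bool) : ZMod 2 := if b then 1 else 0

theorem bit_injective : Function.Injective bit := by decide

theorem bit_surjective : Function.Surjective bit := by decide

theorem bit_and : ∀ a b, bit (a && b) = bit a * bit b := by decide

theorem bit_xor : ∀ a b, bit (xor a b) = bit a + bit b := by decide

theorem sum_bit {n : ℕ} (g : Fin n → Bool) : ∑ i, bit (g i) = bit (parity g) := by
  induction n with
  | zero => rfl
  | succ n ih => rw [Fin.sum_univ_succ, parity, bit_xor, ih]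

/-- The idempotents of `ℤ₂[C[12,3]]` by their coordinates: each hypothesis is the equality of one
coordinate of the square with that of the element. -/
theorem bool_idempotent_opC : ∀ a b c d e f g h i j k l : Bool,
    (((xor (a && a) (xor (k && b) (xor (b && c) (xor (k && d) (xor (l && e) (xor (e && f) (xor (j && g)
        (xor (l && h) (xor (a && i) (xor (e && j) (xor (j && k) (xor (b && l) false)))))))))))) == a) &&
      ((xor (l && a) (xor (b && b) (xor (g && c) (xor (g && d) (xor (d && e) (xor (a && f) (xor (k && g)
        (xor (b && h) (xor (k && i) (xor (l && j) (xor (a && k) (xor (d && l) false)))))))))))) == b) &&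
      ((xor (h && a) (xor (e && b) (xor (c && c) (xor (l && d) (xor (h && e) (xor (d && f) (xor (l && g)
        (xor (i && h) (xor (d && i) (xor (i && j) (xor (c && k) (xor (e && l) false)))))))))))) == c) &&
      ((xor (c && a) (xor (l && b) (xor (i && c) (xor (d && d) (xor (i && e) (xor (b && f) (xor (b && g)
        (xor (g && h) (xor (g && i) (xor (d && j) (xor (l && k) (xor (c && l) false)))))))))))) == d) &&
      ((xor (j && a) (xor (j && b) (xor (l && c) (xor (a && d) (xor (e && e) (xor (c && f) (xor (e && g)
        (xor (c && h) (xor (l && i) (xor (h && j) (xor (h && k) (xor (a && l) false)))))))))))) == e) &&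
      ((xor (g && a) (xor (i && b) (xor (j && c) (xor (h && d) (xor (k && e) (xor (f && f) (xor (i && g)
        (xor (j && h) (xor (h && i) (xor (k && j) (xor (g && k) (xor (f && l) false)))))))))))) == f) &&
      ((xor (d && a) (xor (d && b) (xor (f && c) (xor (i && d) (xor (g && e) (xor (k && f) (xor (g && g)
        (xor (k && h) (xor (f && i) (xor (b && j) (xor (b && k) (xor (i && l) false)))))))))))) == g) &&
      ((xor (f && a) (xor (h && b) (xor (e && c) (xor (e && d) (xor (j && e) (xor (i && f) (xor (c && g)
        (xor (h && h) (xor (c && i) (xor (f && j) (xor (i && k) (xor (j && l) false)))))))))))) == h) &&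
      ((xor (i && a) (xor (c && b) (xor (h && c) (xor (c && d) (xor (f && e) (xor (g && f) (xor (d && g)
        (xor (f && h) (xor (i && i) (xor (g && j) (xor (d && k) (xor (h && l) false)))))))))))) == i) &&
      ((xor (k && a) (xor (f && b) (xor (a && c) (xor (j && d) (xor (a && e) (xor (h && f) (xor (h && g)
        (xor (e && h) (xor (e && i) (xor (j && j) (xor (f && k) (xor (k && l) false)))))))))))) == j) &&
      ((xor (b && a) (xor (g && b) (xor (k && c) (xor (f && d) (xor (b && e) (xor (j && f) (xor (f && g)
        (xor (a && h) (xor (j && i) (xor (a && j) (xor (k && k) (xor (g && l) false)))))))))))) == k) &&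
      ((xor (e && a) (xor (a && b) (xor (d && c) (xor (b && d) (xor (c && e) (xor (l && f) (xor (a && g)
        (xor (d && h) (xor (b && i) (xor (c && j) (xor (e && k) (xor (l && l) false)))))))))))) == l)) = true →
    (∀ x : Fin 12, ![a, b, c, d, e, f, g, h, i, j, k, l] x = false) ∨
      ∃ (y : Fin 12) (m : Bool), ∀ x, ![a, b, c, d, e, f, g, h, i, j, k, l] x = xor (x == y) m := by
  decide +kernel

theorem qmul_opC_bit (f : Fin 12 → Bool) (c : Fin 12) :
    qmul opC (bit ∘ f) (bit ∘ f) c = bit (parity fun b => f (divC c b) && f b) := by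
  simp only [qmul, opC_eq_iff, ← sum_bit, bit_and]
  rw [Finset.sum_comm]
  simp

/-- The idempotents of `ℤ₂[C[12,3]]` are basis elements, up to adding the sum of all basis
elements. -/
theorem idempotent_opC {p : Fin 12 → ZMod 2} (hp : qmul opC p p = p) :
    p = 0 ∨ ∃ (b : Fin 12) (k : ZMod 2), ∀ x, p x = eb b x + k := by
  obtain ⟨f, rfl⟩ : ∃ f : Fin 12 → Bool, bit ∘ f = p :=
    ⟨fun x => (bit_surjective (p x)).choose, funext fun x => (bit_surjective (p x)).choose_spec⟩
  have h (c : Fin 12) : (parity fun b => f (divC c b) && f b) = f c :=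
    bit_injective ((qmul_opC_bit f c).symm.trans (congrFun hp c))
  have hf : f = ![f 0, f 1, f 2, f 3, f 4, f 5, f 6, f 7, f 8, f 9, f 10, f 11] := by
    ext x
    fin_cases x <;> rfl
  have key := bool_idempotent_opC (f 0) (f 1) (f 2) (f 3) (f 4) (f 5) (f 6) (f 7) (f 8) (f 9)
    (f 10) (f 11) (by
      simp only [Bool.and_eq_true, beq_iff_eq, and_assoc]
      exact ⟨h 0, h 1, h 2, h 3, h 4, h 5, h 6, h 7, h 8, h 9, h 10, h 11⟩)
  rw [← hf] at key
  refine key.imp (fun h0 => ?_) ?_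
  · ext x
    simp [h0, bit]
  · rintro ⟨b, m, hb⟩
    refine ⟨b, bit m, fun x => ?_⟩
    rw [Function.comp_apply, hb, bit_xor]
    simp [eb, bit]

/-- Right multiplication in `ℤ₂[Y]` depends only on the image of the right factor in
`ℤ₂[C[12,3]]`. -/
theorem qmul_opY_apply (u v : Fin 24 → ZMod 2) (z : Fin 24) :
    qmul opY u v z = ∑ x, u x * ∑ b, push proj v b * eb z (opY x (sec b)) := by
  simp only [qmul_apply, sum_push_mul, opY_sec_proj]

/-- Right multiplication by an idempotent of `ℤ₂[Y]` is right multiplication by an element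
of `Y`. -/
theorem exists_qmul_eq_qmul_eb {v : Fin 24 → ZMod 2} (hv : v ≠ 0) (hvv : qmul opY v v = v) :
    ∃ b : Fin 24, ∀ u, qmul opY u v = push (fun x => opY x b) u := by
  have hp : qmul opC (push proj v) (push proj v) = push proj v := by
    rw [← push_qmul proj_opY, hvv]
  obtain h0 | ⟨b, k, hb⟩ := idempotent_opC hp
  · refine absurd ?_ hv
    rw [← hvv]
    ext z
    simp [qmul_opY_apply, h0]
  · refine ⟨sec b, fun u => ?_⟩
    ext z
    simp only [qmul_opY_apply, hb, add_mul, Finset.sum_add_distrib, ← Finset.mul_sum, sum_row,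
      sum_eb_mul, push_apply, mul_zero, add_zero]

/-- The set `𝓦 = 𝓘(ℤ₂[Y])` of idempotents of the quandle ring `ℤ₂[Y]`, where
`Y = 𝓘(ℤ₂[C[12,3]])`, is closed under the quandle-ring multiplication and this
multiplication satisfies the quandle axioms on it; hence
`𝓦 = 𝓘(ℤ₂[𝓘(ℤ₂[C[12,3]])])` is itself a quandle. -/
theorem iterated_idempotents_form_quandle
    (W : Finset (Fin 24 → ZMod 2))
    (hW : W = Finset.univ.filter fun u => u ≠ 0 ∧ qmul opY u u = u) :
    (∀ u ∈ W, ∀ v ∈ W, qmul opY u v ∈ W) ∧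
      (∀ u ∈ W, qmul opY u u = u) ∧
      (∀ u ∈ W, ∀ v ∈ W, ∀ w ∈ W,
        qmul opY (qmul opY u v) w = qmul opY (qmul opY u w) (qmul opY v w)) ∧
      (∀ v ∈ W, Set.BijOn (fun u => qmul opY u v) ↑W ↑W) := by
  subst hW
  simp only [Finset.mem_filter, Finset.mem_univ, true_and]
  have hmul {b : Fin 24} (u v : Fin 24 → ZMod 2) : push (fun x => opY x b) (qmul opY u v) =
      qmul opY (push (fun x => opY x b) u) (push (fun x => opY x b) v) :=
    push_qmul (fun x y => opY_distrib x y b) u v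
  have hinj (b : Fin 24) := push_injective (opY_injective_left b)
  have hclosed : ∀ u, u ≠ 0 ∧ qmul opY u u = u → ∀ v, v ≠ 0 ∧ qmul opY v v = v →
      qmul opY u v ≠ 0 ∧ qmul opY (qmul opY u v) (qmul opY u v) = qmul opY u v := by
    rintro u ⟨hu, huu⟩ v ⟨hv, hvv⟩
    obtain ⟨b, hb⟩ := exists_qmul_eq_qmul_eb hv hvv
    rw [hb, ← hmul, huu]
    exact ⟨fun h => hu (hinj b (h.trans (push_zero _).symm)), rfl⟩
  refine ⟨hclosed, fun u hu => hu.2, ?_, ?_⟩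
  · rintro u - v - w ⟨hw, hww⟩
    obtain ⟨b, hb⟩ := exists_qmul_eq_qmul_eb hw hww
    rw [hb, hb, hb, hmul]
  · intro v hv
    obtain ⟨b, hb⟩ := exists_qmul_eq_qmul_eb hv.1 hv.2
    have hmaps : Set.MapsTo (fun u => qmul opY u v)
        ↑(Finset.univ.filter fun u => u ≠ 0 ∧ qmul opY u u = u)
        ↑(Finset.univ.filter fun u => u ≠ 0 ∧ qmul opY u u = u) := by
      intro u hu
      simp only [Finset.coe_filter, Finset.mem_univ, true_and, Set.mem_ofPred_eq] at hu ⊢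
      exact hclosed u hu v hv
    have hinjOn : Function.Injective fun u => qmul opY u v := by
      simpa only [hb] using hinj b
    exact ⟨hmaps, hinjOn.injOn,
      Finset.surjOn_of_injOn_of_card_le _ hmaps hinjOn.injOn le_rfl⟩
end
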